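/- arXiv:1109.6403 — 10 statements merged into one kernel-verified Lean document; each statement's English description precedes it below -/
import Mathlib

section
/- Suppose the full system holds. Then there exists a real number α such that a₀+a₂+a₄+a₆+a₈ = 1/8 + (1/(4√2))·cos α and b₀+b₂+b₄+b₆+b₈ = 1/8 + (1/(4√2))·sin α; equivalently, (a₀+a₂+a₄+a₆+a₈ − 1/8)² + (b₀+b₂+b₄+b₆+b₈ − 1/8)² = 1/32. -/
theorem exists_cos_sin_of_sq_add_sq_eq_one {u v : ℝ} (h : u ^ 2 + v ^ 2 = 1) :
    ∃ α : ℝ, Real.cos α = u ∧ Real.sin α = v := by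
  have hn : ‖(⟨u, v⟩ : ℂ)‖ = 1 := by
    rw [← sq_eq_sq₀ (norm_nonneg _) zero_le_one, ← Complex.normSq_eq_norm_sq,
      Complex.normSq_mk]
    linarith
  have h0 : (⟨u, v⟩ : ℂ) ≠ 0 := norm_ne_zero_iff.mp (by rw [hn]; exact one_ne_zero)
  exact ⟨Complex.arg ⟨u, v⟩, by rw [Complex.cos_arg h0, hn, div_one],
    by rw [Complex.sin_arg, hn, div_one]⟩


theorem stmt5 (a0 a1 a2 a3 a4 a5 a6 a7 a8 b0 b1 b2 b3 b4 b5 b6 b7 b8 : ℝ)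
    (hN : 2*(a0 + a1 + a2 + a3 + a4 + a5 + a6 + a7 + a8 + b0 + b1 + b2 + b3 + b4 + b5 + b6 + b7 + b8) = 1)
    (hO1 : (a0*a8) + (b0*b8) = 0)
    (hO2 : (a2*a6) + (b2*b6) = 0)
    (hO3 : (a1*a6 + a2*a7) + (b1*b6 + b2*b7) = 0)
    (hO4 : (a0*a7 + a1*a8) + (b0*b7 + b1*b8) = 0)
    (hO5 : (a2*a3 + a5*a6) + (b2*b3 + b5*b6) = 0)
    (hO6 : (a0*a5 + a3*a8) + (b0*b5 + b3*b8) = 0)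
    (hO7 : (a0*a6 + a1*a7 + a2*a8) + (b0*b6 + b1*b7 + b2*b8) = 0)
    (hO8 : (a0*a2 + a3*a5 + a6*a8) + (b0*b2 + b3*b5 + b6*b8) = 0)
    (hO9 : (a1*a3 + a2*a4 + a4*a6 + a5*a7) + (b1*b3 + b2*b4 + b4*b6 + b5*b7) = 0)
    (hO10 : (a0*a4 + a1*a5 + a3*a7 + a4*a8) + (b0*b4 + b1*b5 + b3*b7 + b4*b8) = 0)
    (hO11 : (a0*a3 + a1*a4 + a2*a5 + a3*a6 + a4*a7 + a5*a8) + (b0*b3 + b1*b4 + b2*b5 + b3*b6 + b4*b7 + b5*b8) = 0)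
    (hO12 : (a0*a1 + a1*a2 + a3*a4 + a4*a5 + a6*a7 + a7*a8) + (b0*b1 + b1*b2 + b3*b4 + b4*b5 + b6*b7 + b7*b8) = 0)
    (hO13 : a0^2 + a1^2 + a2^2 + a3^2 + a4^2 + a5^2 + a6^2 + a7^2 + a8^2 + b0^2 + b1^2 + b2^2 + b3^2 + b4^2 + b5^2 + b6^2 + b7^2 + b8^2 = 1/8)
    (hV1 : a0 + a1 + a2 = b0 + b1 + b2)
    (hV2 : a3 + a4 + a5 = b3 + b4 + b5)
    (hV3 : a6 + a7 + a8 = b6 + b7 + b8)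
    (hV4 : a0 + a3 + a6 = b2 + b5 + b8)
    (hV5 : a1 + a4 + a7 = b1 + b4 + b7)
    (hV6 : a2 + a5 + a8 = b0 + b3 + b6) :
    (∃ α : ℝ,
      a0 + a2 + a4 + a6 + a8 = 1/8 + (1/(4*Real.sqrt 2)) * Real.cos α ∧
      b0 + b2 + b4 + b6 + b8 = 1/8 + (1/(4*Real.sqrt 2)) * Real.sin α) ∧
    (a0 + a2 + a4 + a6 + a8 - 1/8)^2 + (b0 + b2 + b4 + b6 + b8 - 1/8)^2 = 1/32 := by
  have ha : a0 + a2 + a4 + a6 + a8 - 1/8 =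
      (a0 - a1 + a2 - a3 + a4 - a5 + a6 - a7 + a8) / 2 := by linarith
  have hb : b0 + b2 + b4 + b6 + b8 - 1/8 =
      (b0 - b1 + b2 - b3 + b4 - b5 + b6 - b7 + b8) / 2 := by linarith
  have key : (a0 + a2 + a4 + a6 + a8 - 1/8)^2 + (b0 + b2 + b4 + b6 + b8 - 1/8)^2 = 1/32 := by
    rw [ha, hb]
    linear_combination (1/4) * hO13 + (1/2) * (hO1 + hO2 - hO3 - hO4 - hO5 - hO6 + hO7 + hO8
      + hO9 + hO10 - hO11 - hO12)
  refine ⟨?_, key⟩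
  have h2 : Real.sqrt 2 ^ 2 = 2 := Real.sq_sqrt zero_le_two
  obtain ⟨α, hc, hs⟩ := exists_cos_sin_of_sq_add_sq_eq_one
    (u := 4 * Real.sqrt 2 * (a0 + a2 + a4 + a6 + a8 - 1/8))
    (v := 4 * Real.sqrt 2 * (b0 + b2 + b4 + b6 + b8 - 1/8))
    (by rw [mul_pow, mul_pow, mul_pow, mul_pow, h2]; linarith)
  refine ⟨α, ?_, ?_⟩
  · rw [hc, ← mul_assoc, one_div_mul_cancel (by positivity)]
    ring
  · rw [hs, ← mul_assoc, one_div_mul_cancel (by positivity)]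
    ring
end

section
/- Suppose the full system holds. Then a₁+a₄+a₇ = b₁+b₄+b₇, and either a₁+a₄+a₇ = 0 or a₁+a₄+a₇ = 1/4. -/
theorem stmt6 (a0 a1 a2 a3 a4 a5 a6 a7 a8 b0 b1 b2 b3 b4 b5 b6 b7 b8 : ℝ)
    (hN : 2*(a0 + a1 + a2 + a3 + a4 + a5 + a6 + a7 + a8 + b0 + b1 + b2 + b3 + b4 + b5 + b6 + b7 + b8) = 1)
    (hO1 : (a0*a8) + (b0*b8) = 0)
    (hO2 : (a2*a6) + (b2*b6) = 0)
    (hO3 : (a1*a6 + a2*a7) + (b1*b6 + b2*b7) = 0)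
    (hO4 : (a0*a7 + a1*a8) + (b0*b7 + b1*b8) = 0)
    (hO5 : (a2*a3 + a5*a6) + (b2*b3 + b5*b6) = 0)
    (hO6 : (a0*a5 + a3*a8) + (b0*b5 + b3*b8) = 0)
    (hO7 : (a0*a6 + a1*a7 + a2*a8) + (b0*b6 + b1*b7 + b2*b8) = 0)
    (hO8 : (a0*a2 + a3*a5 + a6*a8) + (b0*b2 + b3*b5 + b6*b8) = 0)
    (hO9 : (a1*a3 + a2*a4 + a4*a6 + a5*a7) + (b1*b3 + b2*b4 + b4*b6 + b5*b7) = 0)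
    (hO10 : (a0*a4 + a1*a5 + a3*a7 + a4*a8) + (b0*b4 + b1*b5 + b3*b7 + b4*b8) = 0)
    (hO11 : (a0*a3 + a1*a4 + a2*a5 + a3*a6 + a4*a7 + a5*a8) + (b0*b3 + b1*b4 + b2*b5 + b3*b6 + b4*b7 + b5*b8) = 0)
    (hO12 : (a0*a1 + a1*a2 + a3*a4 + a4*a5 + a6*a7 + a7*a8) + (b0*b1 + b1*b2 + b3*b4 + b4*b5 + b6*b7 + b7*b8) = 0)
    (hO13 : a0^2 + a1^2 + a2^2 + a3^2 + a4^2 + a5^2 + a6^2 + a7^2 + a8^2 + b0^2 + b1^2 + b2^2 + b3^2 + b4^2 + b5^2 + b6^2 + b7^2 + b8^2 = 1/8)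
    (hV1 : a0 + a1 + a2 = b0 + b1 + b2)
    (hV2 : a3 + a4 + a5 = b3 + b4 + b5)
    (hV3 : a6 + a7 + a8 = b6 + b7 + b8)
    (hV4 : a0 + a3 + a6 = b2 + b5 + b8)
    (hV5 : a1 + a4 + a7 = b1 + b4 + b7)
    (hV6 : a2 + a5 + a8 = b0 + b3 + b6) :
    a1 + a4 + a7 = b1 + b4 + b7 ∧ (a1 + a4 + a7 = 0 ∨ a1 + a4 + a7 = 1/4) := by
  have hsum : (a0 + a3 + a6) + (a1 + a4 + a7) + (a2 + a5 + a8) = 1/4 := by linarith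
  -- Restricting the second variable to `1` leaves a one-variable orthonormality system.
  have hinner : (a1 + a4 + a7) * ((a0 + a3 + a6) + (a2 + a5 + a8)) = 0 := by
    have h : (a1 + a4 + a7) * ((a0 + a3 + a6) + (a2 + a5 + a8))
        + (b1 + b4 + b7) * ((b0 + b3 + b6) + (b2 + b5 + b8)) = 0 := by
      linear_combination hO3 + hO4 + hO9 + hO10 + hO12
    rw [← hV4, ← hV5, ← hV6] at h
    linarith
  refine ⟨hV5, (mul_eq_zero.mp hinner).imp_right fun h => ?_⟩
  linarith
end

section
/- Suppose the full system holds. Then a₃+a₄+a₅ = b₃+b₄+b₅, and either a₃+a₄+a₅ = 0 or a₃+a₄+a₅ = 1/4. -/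
theorem stmt7 (a0 a1 a2 a3 a4 a5 a6 a7 a8 b0 b1 b2 b3 b4 b5 b6 b7 b8 : ℝ)
    (hN : 2*(a0 + a1 + a2 + a3 + a4 + a5 + a6 + a7 + a8 + b0 + b1 + b2 + b3 + b4 + b5 + b6 + b7 + b8) = 1)
    (hO1 : (a0*a8) + (b0*b8) = 0)
    (hO2 : (a2*a6) + (b2*b6) = 0)
    (hO3 : (a1*a6 + a2*a7) + (b1*b6 + b2*b7) = 0)
    (hO4 : (a0*a7 + a1*a8) + (b0*b7 + b1*b8) = 0)
    (hO5 : (a2*a3 + a5*a6) + (b2*b3 + b5*b6) = 0)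
    (hO6 : (a0*a5 + a3*a8) + (b0*b5 + b3*b8) = 0)
    (hO7 : (a0*a6 + a1*a7 + a2*a8) + (b0*b6 + b1*b7 + b2*b8) = 0)
    (hO8 : (a0*a2 + a3*a5 + a6*a8) + (b0*b2 + b3*b5 + b6*b8) = 0)
    (hO9 : (a1*a3 + a2*a4 + a4*a6 + a5*a7) + (b1*b3 + b2*b4 + b4*b6 + b5*b7) = 0)
    (hO10 : (a0*a4 + a1*a5 + a3*a7 + a4*a8) + (b0*b4 + b1*b5 + b3*b7 + b4*b8) = 0)
    (hO11 : (a0*a3 + a1*a4 + a2*a5 + a3*a6 + a4*a7 + a5*a8) + (b0*b3 + b1*b4 + b2*b5 + b3*b6 + b4*b7 + b5*b8) = 0)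
    (hO12 : (a0*a1 + a1*a2 + a3*a4 + a4*a5 + a6*a7 + a7*a8) + (b0*b1 + b1*b2 + b3*b4 + b4*b5 + b6*b7 + b7*b8) = 0)
    (hO13 : a0^2 + a1^2 + a2^2 + a3^2 + a4^2 + a5^2 + a6^2 + a7^2 + a8^2 + b0^2 + b1^2 + b2^2 + b3^2 + b4^2 + b5^2 + b6^2 + b7^2 + b8^2 = 1/8)
    (hV1 : a0 + a1 + a2 = b0 + b1 + b2)
    (hV2 : a3 + a4 + a5 = b3 + b4 + b5)
    (hV3 : a6 + a7 + a8 = b6 + b7 + b8)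
    (hV4 : a0 + a3 + a6 = b2 + b5 + b8)
    (hV5 : a1 + a4 + a7 = b1 + b4 + b7)
    (hV6 : a2 + a5 + a8 = b0 + b3 + b6) :
    a3 + a4 + a5 = b3 + b4 + b5 ∧ (a3 + a4 + a5 = 0 ∨ a3 + a4 + a5 = 1/4) := by
  refine ⟨hV2, ?_⟩
  have hsum : (a0 + a1 + a2) + (a3 + a4 + a5) + (a6 + a7 + a8) = 1 / 4 := by linarith
  have hprod : (a3 + a4 + a5) * ((a0 + a1 + a2) + (a6 + a7 + a8)) = 0 := by
    have hb : (b3 + b4 + b5) * ((b0 + b1 + b2) + (b6 + b7 + b8)) =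
        (a3 + a4 + a5) * ((a0 + a1 + a2) + (a6 + a7 + a8)) := by rw [hV1, hV2, hV3]
    linarith
  exact (mul_eq_zero.mp hprod).imp_right fun h => by linarith
end

section
/- Suppose the full system holds and additionally a₁+a₄+a₇ = 1/4 and a₃+a₄+a₅ = 1/4 (Case 1). Then a₀+a₁+a₂ = 0, a₆+a₇+a₈ = 0, b₀+b₁+b₂ = 0, b₆+b₇+b₈ = 0, a₀+a₃+a₆ = 0, a₂+a₅+a₈ = 0, b₀+b₃+b₆ = 0, and b₂+b₅+b₈ = 0. -/
theorem stmt8 (a0 a1 a2 a3 a4 a5 a6 a7 a8 b0 b1 b2 b3 b4 b5 b6 b7 b8 : ℝ)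
    (hN : 2*(a0 + a1 + a2 + a3 + a4 + a5 + a6 + a7 + a8 + b0 + b1 + b2 + b3 + b4 + b5 + b6 + b7 + b8) = 1)
    (hO1 : (a0*a8) + (b0*b8) = 0)
    (hO2 : (a2*a6) + (b2*b6) = 0)
    (hO3 : (a1*a6 + a2*a7) + (b1*b6 + b2*b7) = 0)
    (hO4 : (a0*a7 + a1*a8) + (b0*b7 + b1*b8) = 0)
    (hO5 : (a2*a3 + a5*a6) + (b2*b3 + b5*b6) = 0)
    (hO6 : (a0*a5 + a3*a8) + (b0*b5 + b3*b8) = 0)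
    (hO7 : (a0*a6 + a1*a7 + a2*a8) + (b0*b6 + b1*b7 + b2*b8) = 0)
    (hO8 : (a0*a2 + a3*a5 + a6*a8) + (b0*b2 + b3*b5 + b6*b8) = 0)
    (hO9 : (a1*a3 + a2*a4 + a4*a6 + a5*a7) + (b1*b3 + b2*b4 + b4*b6 + b5*b7) = 0)
    (hO10 : (a0*a4 + a1*a5 + a3*a7 + a4*a8) + (b0*b4 + b1*b5 + b3*b7 + b4*b8) = 0)
    (hO11 : (a0*a3 + a1*a4 + a2*a5 + a3*a6 + a4*a7 + a5*a8) + (b0*b3 + b1*b4 + b2*b5 + b3*b6 + b4*b7 + b5*b8) = 0)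
    (hO12 : (a0*a1 + a1*a2 + a3*a4 + a4*a5 + a6*a7 + a7*a8) + (b0*b1 + b1*b2 + b3*b4 + b4*b5 + b6*b7 + b7*b8) = 0)
    (hO13 : a0^2 + a1^2 + a2^2 + a3^2 + a4^2 + a5^2 + a6^2 + a7^2 + a8^2 + b0^2 + b1^2 + b2^2 + b3^2 + b4^2 + b5^2 + b6^2 + b7^2 + b8^2 = 1/8)
    (hV1 : a0 + a1 + a2 = b0 + b1 + b2)
    (hV2 : a3 + a4 + a5 = b3 + b4 + b5)
    (hV3 : a6 + a7 + a8 = b6 + b7 + b8)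
    (hV4 : a0 + a3 + a6 = b2 + b5 + b8)
    (hV5 : a1 + a4 + a7 = b1 + b4 + b7)
    (hV6 : a2 + a5 + a8 = b0 + b3 + b6)
    (hC1 : a1 + a4 + a7 = 1/4)
    (hC2 : a3 + a4 + a5 = 1/4) :
    a0 + a1 + a2 = 0 ∧ a6 + a7 + a8 = 0 ∧ b0 + b1 + b2 = 0 ∧ b6 + b7 + b8 = 0 ∧
    a0 + a3 + a6 = 0 ∧ a2 + a5 + a8 = 0 ∧ b0 + b3 + b6 = 0 ∧ b2 + b5 + b8 = 0 := by
  have hrow : a6 + a7 + a8 = -(a0 + a1 + a2) := by linarith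
  have hcol : a2 + a5 + a8 = -(a0 + a3 + a6) := by linarith
  have hrowprod : (a0 + a1 + a2) * (a6 + a7 + a8) + (b0 + b1 + b2) * (b6 + b7 + b8) = 0 := by
    linear_combination hO1 + hO2 + hO3 + hO4 + hO7
  have hcolprod : (a0 + a3 + a6) * (a2 + a5 + a8) + (b0 + b3 + b6) * (b2 + b5 + b8) = 0 := by
    linear_combination hO1 + hO2 + hO5 + hO6 + hO8
  rw [← hV1, ← hV3, hrow] at hrowprod
  rw [← hV4, ← hV6, hcol] at hcolprod
  have hrow0 : a0 + a1 + a2 = 0 := pow_eq_zero_iff two_ne_zero |>.mp (by linarith)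
  have hcol0 : a0 + a3 + a6 = 0 := pow_eq_zero_iff two_ne_zero |>.mp (by linarith)
  refine ⟨?_, ?_, ?_, ?_, ?_, ?_, ?_, ?_⟩ <;> linarith
end

section
/- Suppose the full system holds and additionally a₁+a₄+a₇ = 1/4 and a₃+a₄+a₅ = 1/4 (Case 1). Then a₃a₅ + b₃b₅ = 0 and a₁a₇ + b₁b₇ = 0. -/
theorem stmt9 (a0 a1 a2 a3 a4 a5 a6 a7 a8 b0 b1 b2 b3 b4 b5 b6 b7 b8 : ℝ)
    (hN : 2*(a0 + a1 + a2 + a3 + a4 + a5 + a6 + a7 + a8 + b0 + b1 + b2 + b3 + b4 + b5 + b6 + b7 + b8) = 1)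
    (hO1 : (a0*a8) + (b0*b8) = 0)
    (hO2 : (a2*a6) + (b2*b6) = 0)
    (hO3 : (a1*a6 + a2*a7) + (b1*b6 + b2*b7) = 0)
    (hO4 : (a0*a7 + a1*a8) + (b0*b7 + b1*b8) = 0)
    (hO5 : (a2*a3 + a5*a6) + (b2*b3 + b5*b6) = 0)
    (hO6 : (a0*a5 + a3*a8) + (b0*b5 + b3*b8) = 0)
    (hO7 : (a0*a6 + a1*a7 + a2*a8) + (b0*b6 + b1*b7 + b2*b8) = 0)
    (hO8 : (a0*a2 + a3*a5 + a6*a8) + (b0*b2 + b3*b5 + b6*b8) = 0)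
    (hO9 : (a1*a3 + a2*a4 + a4*a6 + a5*a7) + (b1*b3 + b2*b4 + b4*b6 + b5*b7) = 0)
    (hO10 : (a0*a4 + a1*a5 + a3*a7 + a4*a8) + (b0*b4 + b1*b5 + b3*b7 + b4*b8) = 0)
    (hO11 : (a0*a3 + a1*a4 + a2*a5 + a3*a6 + a4*a7 + a5*a8) + (b0*b3 + b1*b4 + b2*b5 + b3*b6 + b4*b7 + b5*b8) = 0)
    (hO12 : (a0*a1 + a1*a2 + a3*a4 + a4*a5 + a6*a7 + a7*a8) + (b0*b1 + b1*b2 + b3*b4 + b4*b5 + b6*b7 + b7*b8) = 0)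
    (hO13 : a0^2 + a1^2 + a2^2 + a3^2 + a4^2 + a5^2 + a6^2 + a7^2 + a8^2 + b0^2 + b1^2 + b2^2 + b3^2 + b4^2 + b5^2 + b6^2 + b7^2 + b8^2 = 1/8)
    (hV1 : a0 + a1 + a2 = b0 + b1 + b2)
    (hV2 : a3 + a4 + a5 = b3 + b4 + b5)
    (hV3 : a6 + a7 + a8 = b6 + b7 + b8)
    (hV4 : a0 + a3 + a6 = b2 + b5 + b8)
    (hV5 : a1 + a4 + a7 = b1 + b4 + b7)
    (hV6 : a2 + a5 + a8 = b0 + b3 + b6)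
    (hC1 : a1 + a4 + a7 = 1/4)
    (hC2 : a3 + a4 + a5 = 1/4) :
    a3*a5 + b3*b5 = 0 ∧ a1*a7 + b1*b7 = 0 := by
  have hrow_add : a0 + a1 + a2 + (a6 + a7 + a8) = 0 := by linarith
  have hrow_mul : (a0 + a1 + a2) * (a6 + a7 + a8) + (b0 + b1 + b2) * (b6 + b7 + b8) = 0 := by
    linear_combination hO1 + hO2 + hO3 + hO4 + hO7
  rw [← hV1, ← hV3] at hrow_mul
  have hrow : a0 + a1 + a2 = 0 := by
    refine pow_eq_zero_iff two_ne_zero |>.mp ?_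
    linear_combination (a0 + a1 + a2) * hrow_add - hrow_mul / 2
  have hcol_add : a0 + a3 + a6 + (a2 + a5 + a8) = 0 := by linarith
  have hcol_mul : (a0 + a3 + a6) * (a2 + a5 + a8) + (b0 + b3 + b6) * (b2 + b5 + b8) = 0 := by
    linear_combination hO1 + hO2 + hO5 + hO6 + hO8
  rw [← hV4, ← hV6] at hcol_mul
  have hcol : a0 + a3 + a6 = 0 := by
    refine pow_eq_zero_iff two_ne_zero |>.mp ?_
    linear_combination (a0 + a3 + a6) * hcol_add - hcol_mul / 2
  obtain rfl : a3 = -a0 - a6 := by linarith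
  obtain rfl : a5 = -a2 - a8 := by linarith
  obtain rfl : b3 = -b0 - b6 := by linarith
  obtain rfl : b5 = -b2 - b8 := by linarith
  obtain rfl : a1 = -a0 - a2 := by linarith
  obtain rfl : a7 = -a6 - a8 := by linarith
  obtain rfl : b1 = -b0 - b2 := by linarith
  obtain rfl : b7 = -b6 - b8 := by linarith
  constructor
  · linear_combination hO8 / 2 + hO1 / 2 + hO2 / 2
  · linear_combination hO7 / 2 + hO1 / 2 + hO2 / 2
end

section
/- (Theorem 3.2, forward direction.) Let β, γ be arbitrary real numbers and set α = 2(β−γ)+π/4, p = 1/16 − cos α/(8√2), q = 1/16 − sin α/(8√2), and r = √(p²+q²). Define a₀ = (−p(1+cos(β−γ)) − q·sin(β−γ) − r(cos β + cos γ))/4; a₂ = (−p(1−cos(β−γ)) + q·sin(β−γ) − r(cos β − cos γ))/4; a₆ = (−p(1−cos(β−γ)) + q·sin(β−γ) + r(cos β − cos γ))/4; a₈ = (−p(1+cos(β−γ)) − q·sin(β−γ) + r(cos β + cos γ))/4; b₀ = (−q(1+cos(β−γ)) + p·sin(β−γ) − r(sin β + sin γ))/4; b₂ = (−q(1−cos(β−γ))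 − p·sin(β−γ) − r(sin β − sin γ))/4; b₆ = (−q(1−cos(β−γ)) − p·sin(β−γ) + r(sin β − sin γ))/4; b₈ = (−q(1+cos(β−γ)) + p·sin(β−γ) + r(sin β + sin γ))/4; a₁ = p/2 + (r/2)cos β; b₁ = q/2 + (r/2)sin β; a₃ = p/2 + (r/2)cos γ; b₃ = q/2 + (r/2)sin γ; a₅ = p/2 − (r/2)cos γ; b₅ = q/2 − (r/2)sin γ; a₇ = p/2 − (r/2)cos β; b₇ = q/2 − (r/2)sin β; a₄ = 1/4 − p; b₄ = 1/4 − q. Then these a_i, b_i satisfy the full system, and moreover a₁+a₄+a₇ = 1/4 and a₃+a₄+a₅ = 1/4. -/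
theorem stmt10 (a0 a1 a2 a3 a4 a5 a6 a7 a8 b0 b1 b2 b3 b4 b5 b6 b7 b8 : ℝ) (β γ α p q r : ℝ)
    (hα : α = 2*(β - γ) + Real.pi/4)
    (hp : p = 1/16 - Real.cos α/(8*Real.sqrt 2))
    (hq : q = 1/16 - Real.sin α/(8*Real.sqrt 2))
    (hr : r = Real.sqrt (p^2 + q^2))
    (ha0 : a0 = (-p*(1 + Real.cos (β - γ)) - q*Real.sin (β - γ) - r*(Real.cos β + Real.cos γ))/4)
    (ha2 : a2 = (-p*(1 - Real.cos (β - γ)) + q*Real.sin (β - γ) - r*(Real.cos β - Real.cos γ))/4)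
    (ha6 : a6 = (-p*(1 - Real.cos (β - γ)) + q*Real.sin (β - γ) + r*(Real.cos β - Real.cos γ))/4)
    (ha8 : a8 = (-p*(1 + Real.cos (β - γ)) - q*Real.sin (β - γ) + r*(Real.cos β + Real.cos γ))/4)
    (hb0 : b0 = (-q*(1 + Real.cos (β - γ)) + p*Real.sin (β - γ) - r*(Real.sin β + Real.sin γ))/4)
    (hb2 : b2 = (-q*(1 - Real.cos (β - γ)) - p*Real.sin (β - γ) - r*(Real.sin β - Real.sin γ))/4)
    (hb6 : b6 = (-q*(1 - Real.cos (β - γ)) - p*Real.sin (β - γ) + r*(Real.sin β - Real.sin γ))/4)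
    (hb8 : b8 = (-q*(1 + Real.cos (β - γ)) + p*Real.sin (β - γ) + r*(Real.sin β + Real.sin γ))/4)
    (ha1 : a1 = p/2 + (r/2)*Real.cos β)
    (hb1 : b1 = q/2 + (r/2)*Real.sin β)
    (ha3 : a3 = p/2 + (r/2)*Real.cos γ)
    (hb3 : b3 = q/2 + (r/2)*Real.sin γ)
    (ha5 : a5 = p/2 - (r/2)*Real.cos γ)
    (hb5 : b5 = q/2 - (r/2)*Real.sin γ)
    (ha7 : a7 = p/2 - (r/2)*Real.cos β)
    (hb7 : b7 = q/2 - (r/2)*Real.sin β)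
    (ha4 : a4 = 1/4 - p)
    (hb4 : b4 = 1/4 - q) :
    (2*(a0 + a1 + a2 + a3 + a4 + a5 + a6 + a7 + a8 + b0 + b1 + b2 + b3 + b4 + b5 + b6 + b7 + b8) = 1) ∧
    ((a0*a8) + (b0*b8) = 0) ∧
    ((a2*a6) + (b2*b6) = 0) ∧
    ((a1*a6 + a2*a7) + (b1*b6 + b2*b7) = 0) ∧
    ((a0*a7 + a1*a8) + (b0*b7 + b1*b8) = 0) ∧
    ((a2*a3 + a5*a6) + (b2*b3 + b5*b6) = 0) ∧
    ((a0*a5 + a3*a8) + (b0*b5 + b3*b8) = 0) ∧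
    ((a0*a6 + a1*a7 + a2*a8) + (b0*b6 + b1*b7 + b2*b8) = 0) ∧
    ((a0*a2 + a3*a5 + a6*a8) + (b0*b2 + b3*b5 + b6*b8) = 0) ∧
    ((a1*a3 + a2*a4 + a4*a6 + a5*a7) + (b1*b3 + b2*b4 + b4*b6 + b5*b7) = 0) ∧
    ((a0*a4 + a1*a5 + a3*a7 + a4*a8) + (b0*b4 + b1*b5 + b3*b7 + b4*b8) = 0) ∧
    ((a0*a3 + a1*a4 + a2*a5 + a3*a6 + a4*a7 + a5*a8) + (b0*b3 + b1*b4 + b2*b5 + b3*b6 + b4*b7 + b5*b8) = 0) ∧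
    ((a0*a1 + a1*a2 + a3*a4 + a4*a5 + a6*a7 + a7*a8) + (b0*b1 + b1*b2 + b3*b4 + b4*b5 + b6*b7 + b7*b8) = 0) ∧
    (a0^2 + a1^2 + a2^2 + a3^2 + a4^2 + a5^2 + a6^2 + a7^2 + a8^2 + b0^2 + b1^2 + b2^2 + b3^2 + b4^2 + b5^2 + b6^2 + b7^2 + b8^2 = 1/8) ∧
    (a0 + a1 + a2 = b0 + b1 + b2) ∧
    (a3 + a4 + a5 = b3 + b4 + b5) ∧
    (a6 + a7 + a8 = b6 + b7 + b8) ∧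
    (a0 + a3 + a6 = b2 + b5 + b8) ∧
    (a1 + a4 + a7 = b1 + b4 + b7) ∧
    (a2 + a5 + a8 = b0 + b3 + b6) ∧
    (a1 + a4 + a7 = 1/4) ∧ (a3 + a4 + a5 = 1/4) := by
  have hβ := Real.sin_sq_add_cos_sq β
  have hδ := Real.sin_sq_add_cos_sq (β - γ)
  have hC := Real.cos_sub β γ
  have hS := Real.sin_sub β γ
  have hr2 : r ^ 2 = p ^ 2 + q ^ 2 := by rw [hr]; exact Real.sq_sqrt (by positivity)
  have hp' : p = Real.sin (β - γ) * (Real.sin (β - γ) + Real.cos (β - γ)) / 8 := by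
    rw [hp, hα, Real.cos_add, Real.cos_two_mul, Real.sin_two_mul, Real.cos_pi_div_four,
      Real.sin_pi_div_four]
    field_simp
    linear_combination -32 * hδ
  have hq' : q = Real.sin (β - γ) * (Real.sin (β - γ) - Real.cos (β - γ)) / 8 := by
    rw [hq, hα, Real.sin_add, Real.cos_two_mul, Real.sin_two_mul, Real.cos_pi_div_four,
      Real.sin_pi_div_four]
    field_simp
    linear_combination -32 * hδ
  clear hp hq hr hα
  generalize Real.sin (β - γ) = S at *
  generalize Real.cos (β - γ) = C at *
  generalize Real.sin β = x at *
  generalize Real.cos β = y at *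
  generalize Real.sin γ = z at *
  generalize Real.cos γ = w at *
  have hw : w = y * C + x * S := by subst hC hS; linear_combination -w * hβ
  have hz : z = x * C - y * S := by subst hC hS; linear_combination -z * hβ
  replace hr2 : r ^ 2 = S ^ 2 / 32 := by
    rw [hr2, hp', hq']
    linear_combination S ^ 2 / 32 * hδ
  subst ha0 ha1 ha2 ha3 ha4 ha5 ha6 ha7 ha8 hb0 hb1 hb2 hb3 hb4 hb5 hb6 hb7 hb8
  clear hC hS
  subst hw hz
  subst hp' hq'
  refine ⟨?_, ?_, ?_, ?_, ?_, ?_, ?_, ?_, ?_, ?_, ?_, ?_, ?_, ?_, ?_, ?_, ?_, ?_, ?_, ?_, ?_, ?_⟩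
  all_goals grind
end

section
/- Suppose the full system holds and additionally a₁+a₄+a₇ = 1/4 and a₃+a₄+a₅ = 0 (Case 2). Then there exists a real number α with a₄ = 1/16 + cos α/(8√2) and b₄ = 1/16 + sin α/(8√2), and moreover either (a₆+a₇+a₈ = 0 and a₀+a₁+a₂ = 1/4) or (a₆+a₇+a₈ = 1/4 and a₀+a₁+a₂ = 0). -/
theorem exists_eq_cos_sin_of_sq_add_sq_eq_one {x y : ℝ} (h : x ^ 2 + y ^ 2 = 1) :
    ∃ α : ℝ, x = Real.cos α ∧ y = Real.sin α := by
  have hz : ‖(⟨x, y⟩ : ℂ)‖ = 1 := by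
    rw [Complex.norm_def, Complex.normSq_mk, ← sq, ← sq, h, Real.sqrt_one]
  refine ⟨Complex.arg ⟨x, y⟩, ?_, ?_⟩
  · have := Complex.norm_mul_cos_arg ⟨x, y⟩
    rw [hz, one_mul] at this
    exact this.symm
  · have := Complex.norm_mul_sin_arg ⟨x, y⟩
    rw [hz, one_mul] at this
    exact this.symm

theorem exists_circle_param {u v c : ℝ} (h : (u - c) ^ 2 + (v - c) ^ 2 = 1 / 128) :
    ∃ α : ℝ, u = c + Real.cos α / (8 * Real.sqrt 2) ∧ v = c + Real.sin α / (8 * Real.sqrt 2) := by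
  have h2 : Real.sqrt 2 ^ 2 = 2 := Real.sq_sqrt (by norm_num)
  have hpos : (8 * Real.sqrt 2) ≠ 0 := by positivity
  obtain ⟨α, hx, hy⟩ := exists_eq_cos_sin_of_sq_add_sq_eq_one
    (x := (u - c) * (8 * Real.sqrt 2)) (y := (v - c) * (8 * Real.sqrt 2))
    (by linear_combination 64 * Real.sqrt 2 ^ 2 * h + h2 / 2)
  refine ⟨α, ?_, ?_⟩
  · rw [← hx, mul_div_cancel_right₀ _ hpos]; ring
  · rw [← hy, mul_div_cancel_right₀ _ hpos]; ring

theorem stmt12 (a0 a1 a2 a3 a4 a5 a6 a7 a8 b0 b1 b2 b3 b4 b5 b6 b7 b8 : ℝ)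
    (hN : 2*(a0 + a1 + a2 + a3 + a4 + a5 + a6 + a7 + a8 + b0 + b1 + b2 + b3 + b4 + b5 + b6 + b7 + b8) = 1)
    (hO1 : (a0*a8) + (b0*b8) = 0)
    (hO2 : (a2*a6) + (b2*b6) = 0)
    (hO3 : (a1*a6 + a2*a7) + (b1*b6 + b2*b7) = 0)
    (hO4 : (a0*a7 + a1*a8) + (b0*b7 + b1*b8) = 0)
    (hO5 : (a2*a3 + a5*a6) + (b2*b3 + b5*b6) = 0)
    (hO6 : (a0*a5 + a3*a8) + (b0*b5 + b3*b8) = 0)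
    (hO7 : (a0*a6 + a1*a7 + a2*a8) + (b0*b6 + b1*b7 + b2*b8) = 0)
    (hO8 : (a0*a2 + a3*a5 + a6*a8) + (b0*b2 + b3*b5 + b6*b8) = 0)
    (hO9 : (a1*a3 + a2*a4 + a4*a6 + a5*a7) + (b1*b3 + b2*b4 + b4*b6 + b5*b7) = 0)
    (hO10 : (a0*a4 + a1*a5 + a3*a7 + a4*a8) + (b0*b4 + b1*b5 + b3*b7 + b4*b8) = 0)
    (hO11 : (a0*a3 + a1*a4 + a2*a5 + a3*a6 + a4*a7 + a5*a8) + (b0*b3 + b1*b4 + b2*b5 + b3*b6 + b4*b7 + b5*b8) = 0)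
    (hO12 : (a0*a1 + a1*a2 + a3*a4 + a4*a5 + a6*a7 + a7*a8) + (b0*b1 + b1*b2 + b3*b4 + b4*b5 + b6*b7 + b7*b8) = 0)
    (hO13 : a0^2 + a1^2 + a2^2 + a3^2 + a4^2 + a5^2 + a6^2 + a7^2 + a8^2 + b0^2 + b1^2 + b2^2 + b3^2 + b4^2 + b5^2 + b6^2 + b7^2 + b8^2 = 1/8)
    (hV1 : a0 + a1 + a2 = b0 + b1 + b2)
    (hV2 : a3 + a4 + a5 = b3 + b4 + b5)
    (hV3 : a6 + a7 + a8 = b6 + b7 + b8)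
    (hV4 : a0 + a3 + a6 = b2 + b5 + b8)
    (hV5 : a1 + a4 + a7 = b1 + b4 + b7)
    (hV6 : a2 + a5 + a8 = b0 + b3 + b6)
    (hC1 : a1 + a4 + a7 = 1/4)
    (hC2 : a3 + a4 + a5 = 0) :
    (∃ α : ℝ,
      a4 = 1/16 + Real.cos α/(8*Real.sqrt 2) ∧
      b4 = 1/16 + Real.sin α/(8*Real.sqrt 2)) ∧
    ((a6 + a7 + a8 = 0 ∧ a0 + a1 + a2 = 1/4) ∨
     (a6 + a7 + a8 = 1/4 ∧ a0 + a1 + a2 = 0)) := by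
  have hrow_sum : (a0 + a1 + a2) + (a6 + a7 + a8) = 1/4 := by linarith
  have hrow_mul : (a0 + a1 + a2) * (a6 + a7 + a8) = 0 := by
    have hb : (b0 + b1 + b2) * (b6 + b7 + b8) = (a0 + a1 + a2) * (a6 + a7 + a8) := by
      rw [hV1, hV3]
    linarith
  have hcol_sum : (a0 + a3 + a6) + (a2 + a5 + a8) = 0 := by linarith
  have hcol_mul : (a0 + a3 + a6) * (a2 + a5 + a8) = 0 := by
    have hb : (b0 + b3 + b6) * (b2 + b5 + b8) = (a2 + a5 + a8) * (a0 + a3 + a6) := by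
      rw [hV4, hV6]
    linarith
  have hcol0 : a0 + a3 + a6 = 0 := by
    rcases mul_eq_zero.mp hcol_mul with h | h <;> linarith
  have hcol2 : a2 + a5 + a8 = 0 := by linarith
  have hrow : (a6 + a7 + a8 = 0 ∧ a0 + a1 + a2 = 1/4) ∨
      (a6 + a7 + a8 = 1/4 ∧ a0 + a1 + a2 = 0) := by
    rcases mul_eq_zero.mp hrow_mul with h | h
    · exact Or.inr ⟨by linarith, h⟩
    · exact Or.inl ⟨h, by linarith⟩
  refine ⟨exists_circle_param ?_, hrow⟩
  have ha3 : a3 = -a0 - a6 := by linarith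
  have ha5 : a5 = -a2 - a8 := by linarith
  have ha4 : a4 = a0 + a2 + a6 + a8 := by linarith
  have hb3 : b3 = -b0 - b6 := by linarith
  have hb5 : b5 = -b2 - b8 := by linarith
  have hb4 : b4 = b0 + b2 + b6 + b8 := by linarith
  rcases hrow with ⟨h2, h0⟩ | ⟨h2, h0⟩
  · have ha1 : a1 = 1/4 - a0 - a2 := by linarith
    have ha7 : a7 = 0 - a6 - a8 := by linarith
    have hb1 : b1 = 1/4 - b0 - b2 := by linarith
    have hb7 : b7 = 0 - b6 - b8 := by linarith
    subst ha1 ha7 hb1 hb7 ha4 ha3 ha5 hb4 hb3 hb5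
    linarith
  · have ha1 : a1 = 0 - a0 - a2 := by linarith
    have ha7 : a7 = 1/4 - a6 - a8 := by linarith
    have hb1 : b1 = 0 - b0 - b2 := by linarith
    have hb7 : b7 = 1/4 - b6 - b8 := by linarith
    subst ha1 ha7 hb1 hb7 ha4 ha3 ha5 hb4 hb3 hb5
    linarith
end

section
/- Suppose the full system holds together with the Subcase 2a conditions a₁+a₄+a₇ = 1/4, a₃+a₄+a₅ = 0, a₆+a₇+a₈ = 0, and a₀+a₁+a₂ = 1/4. Then a₀+a₃+a₆ = 0, b₀+b₃+b₆ = 0, a₂+a₅+a₈ = 0, b₂+b₅+b₈ = 0, and a₃a₅ + b₃b₅ = 0. -/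
theorem stmt13 (a0 a1 a2 a3 a4 a5 a6 a7 a8 b0 b1 b2 b3 b4 b5 b6 b7 b8 : ℝ)
    (hN : 2*(a0 + a1 + a2 + a3 + a4 + a5 + a6 + a7 + a8 + b0 + b1 + b2 + b3 + b4 + b5 + b6 + b7 + b8) = 1)
    (hO1 : (a0*a8) + (b0*b8) = 0)
    (hO2 : (a2*a6) + (b2*b6) = 0)
    (hO3 : (a1*a6 + a2*a7) + (b1*b6 + b2*b7) = 0)
    (hO4 : (a0*a7 + a1*a8) + (b0*b7 + b1*b8) = 0)
    (hO5 : (a2*a3 + a5*a6) + (b2*b3 + b5*b6) = 0)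
    (hO6 : (a0*a5 + a3*a8) + (b0*b5 + b3*b8) = 0)
    (hO7 : (a0*a6 + a1*a7 + a2*a8) + (b0*b6 + b1*b7 + b2*b8) = 0)
    (hO8 : (a0*a2 + a3*a5 + a6*a8) + (b0*b2 + b3*b5 + b6*b8) = 0)
    (hO9 : (a1*a3 + a2*a4 + a4*a6 + a5*a7) + (b1*b3 + b2*b4 + b4*b6 + b5*b7) = 0)
    (hO10 : (a0*a4 + a1*a5 + a3*a7 + a4*a8) + (b0*b4 + b1*b5 + b3*b7 + b4*b8) = 0)
    (hO11 : (a0*a3 + a1*a4 + a2*a5 + a3*a6 + a4*a7 + a5*a8) + (b0*b3 + b1*b4 + b2*b5 + b3*b6 + b4*b7 + b5*b8) = 0)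
    (hO12 : (a0*a1 + a1*a2 + a3*a4 + a4*a5 + a6*a7 + a7*a8) + (b0*b1 + b1*b2 + b3*b4 + b4*b5 + b6*b7 + b7*b8) = 0)
    (hO13 : a0^2 + a1^2 + a2^2 + a3^2 + a4^2 + a5^2 + a6^2 + a7^2 + a8^2 + b0^2 + b1^2 + b2^2 + b3^2 + b4^2 + b5^2 + b6^2 + b7^2 + b8^2 = 1/8)
    (hV1 : a0 + a1 + a2 = b0 + b1 + b2)
    (hV2 : a3 + a4 + a5 = b3 + b4 + b5)
    (hV3 : a6 + a7 + a8 = b6 + b7 + b8)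
    (hV4 : a0 + a3 + a6 = b2 + b5 + b8)
    (hV5 : a1 + a4 + a7 = b1 + b4 + b7)
    (hV6 : a2 + a5 + a8 = b0 + b3 + b6)
    (hC1 : a1 + a4 + a7 = 1/4)
    (hC2 : a3 + a4 + a5 = 0)
    (hC3 : a6 + a7 + a8 = 0)
    (hC4 : a0 + a1 + a2 = 1/4) :
    a0 + a3 + a6 = 0 ∧ b0 + b3 + b6 = 0 ∧ a2 + a5 + a8 = 0 ∧ b2 + b5 + b8 = 0 ∧
    a3*a5 + b3*b5 = 0 := by
  have hprod : (a0 + a3 + a6) * (a2 + a5 + a8) + (b0 + b3 + b6) * (b2 + b5 + b8) = 0 := by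
    linear_combination hO1 + hO2 + hO5 + hO6 + hO8
  have hadj : (a0 + a3 + a6) * (a1 + a4 + a7) + (a1 + a4 + a7) * (a2 + a5 + a8)
      + (b0 + b3 + b6) * (b1 + b4 + b7) + (b1 + b4 + b7) * (b2 + b5 + b8) = 0 := by
    linear_combination hO3 + hO4 + hO9 + hO10 + hO12
  rw [← hV4, ← hV6] at hprod
  rw [← hV4, ← hV5, ← hV6, hC1] at hadj
  have hneg : a2 + a5 + a8 = -(a0 + a3 + a6) := by linear_combination 2 * hadj
  have hA0 : a0 + a3 + a6 = 0 := by
    rw [hneg] at hprod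
    exact pow_eq_zero_iff two_ne_zero |>.mp (by linear_combination -hprod / 2)
  have hA2 : a2 + a5 + a8 = 0 := by rw [hneg, hA0, neg_zero]
  have hB0 : b0 + b3 + b6 = 0 := hV6.symm.trans hA2
  have hB2 : b2 + b5 + b8 = 0 := hV4.symm.trans hA0
  refine ⟨hA0, hB0, hA2, hB2, ?_⟩
  obtain rfl : a6 = -a0 - a3 := by linear_combination hA0
  obtain rfl : b6 = -b0 - b3 := by linear_combination hB0
  obtain rfl : a8 = -a2 - a5 := by linear_combination hA2
  obtain rfl : b8 = -b2 - b5 := by linear_combination hB2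
  linear_combination (hO1 + hO2 + hO8) / 2
end

section
/- (Theorem 4.1, part 1, forward direction.) Let γ be any real number, let ε ∈ {1, −1}, and set S = √(2 + √2(cos γ + sin γ)). Define a₃ = b₃ = a₄ = b₄ = a₅ = b₅ = 0; a₁ = 3/16 − cos γ/(8√2); a₇ = 1/16 + cos γ/(8√2); b₁ = 3/16 − sin γ/(8√2); b₇ = 1/16 + sin γ/(8√2); a₀ = (1 + √2 cos γ + εS)/32; a₂ = (1 + √2 cos γ − εS)/32; a₆ = (−1 − √2 cos γ − εS)/32; a₈ = (−1 − √2 cos γ + εS)/32; b₀ = (1 + √2 sin γ − εS)/32; b₂ = (1 + √2 sin γ + εS)/32; b₆ = (−1 − √2 sin γ + εS)/32; b₈ = (−1 − √2 sin γ − εS)/32. Then these a_i, b_i satisfy the full system, and moreover a₁+a₄+a₇ = 1/4, a₃+a₄+a₅ = 0, a₆+a₇+a₈ = 0, and a₀+a₁+a₂ = 1/4. -/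
theorem stmt14 (a0 a1 a2 a3 a4 a5 a6 a7 a8 b0 b1 b2 b3 b4 b5 b6 b7 b8 : ℝ) (γ ε S : ℝ)
    (hε : ε = 1 ∨ ε = -1)
    (hS : S = Real.sqrt (2 + Real.sqrt 2 * (Real.cos γ + Real.sin γ)))
    (ha3 : a3 = 0)
    (hb3 : b3 = 0)
    (ha4 : a4 = 0)
    (hb4 : b4 = 0)
    (ha5 : a5 = 0)
    (hb5 : b5 = 0)
    (ha1 : a1 = 3/16 - Real.cos γ/(8*Real.sqrt 2))
    (ha7 : a7 = 1/16 + Real.cos γ/(8*Real.sqrt 2))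
    (hb1 : b1 = 3/16 - Real.sin γ/(8*Real.sqrt 2))
    (hb7 : b7 = 1/16 + Real.sin γ/(8*Real.sqrt 2))
    (ha0 : a0 = (1 + Real.sqrt 2 * Real.cos γ + ε*S)/32)
    (ha2 : a2 = (1 + Real.sqrt 2 * Real.cos γ - ε*S)/32)
    (ha6 : a6 = (-1 - Real.sqrt 2 * Real.cos γ - ε*S)/32)
    (ha8 : a8 = (-1 - Real.sqrt 2 * Real.cos γ + ε*S)/32)
    (hb0 : b0 = (1 + Real.sqrt 2 * Real.sin γ - ε*S)/32)
    (hb2 : b2 = (1 + Real.sqrt 2 * Real.sin γ + ε*S)/32)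
    (hb6 : b6 = (-1 - Real.sqrt 2 * Real.sin γ + ε*S)/32)
    (hb8 : b8 = (-1 - Real.sqrt 2 * Real.sin γ - ε*S)/32) :
    (2*(a0 + a1 + a2 + a3 + a4 + a5 + a6 + a7 + a8 + b0 + b1 + b2 + b3 + b4 + b5 + b6 + b7 + b8) = 1) ∧
    ((a0*a8) + (b0*b8) = 0) ∧
    ((a2*a6) + (b2*b6) = 0) ∧
    ((a1*a6 + a2*a7) + (b1*b6 + b2*b7) = 0) ∧
    ((a0*a7 + a1*a8) + (b0*b7 + b1*b8) = 0) ∧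
    ((a2*a3 + a5*a6) + (b2*b3 + b5*b6) = 0) ∧
    ((a0*a5 + a3*a8) + (b0*b5 + b3*b8) = 0) ∧
    ((a0*a6 + a1*a7 + a2*a8) + (b0*b6 + b1*b7 + b2*b8) = 0) ∧
    ((a0*a2 + a3*a5 + a6*a8) + (b0*b2 + b3*b5 + b6*b8) = 0) ∧
    ((a1*a3 + a2*a4 + a4*a6 + a5*a7) + (b1*b3 + b2*b4 + b4*b6 + b5*b7) = 0) ∧
    ((a0*a4 + a1*a5 + a3*a7 + a4*a8) + (b0*b4 + b1*b5 + b3*b7 + b4*b8) = 0) ∧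
    ((a0*a3 + a1*a4 + a2*a5 + a3*a6 + a4*a7 + a5*a8) + (b0*b3 + b1*b4 + b2*b5 + b3*b6 + b4*b7 + b5*b8) = 0) ∧
    ((a0*a1 + a1*a2 + a3*a4 + a4*a5 + a6*a7 + a7*a8) + (b0*b1 + b1*b2 + b3*b4 + b4*b5 + b6*b7 + b7*b8) = 0) ∧
    (a0^2 + a1^2 + a2^2 + a3^2 + a4^2 + a5^2 + a6^2 + a7^2 + a8^2 + b0^2 + b1^2 + b2^2 + b3^2 + b4^2 + b5^2 + b6^2 + b7^2 + b8^2 = 1/8) ∧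
    (a0 + a1 + a2 = b0 + b1 + b2) ∧
    (a3 + a4 + a5 = b3 + b4 + b5) ∧
    (a6 + a7 + a8 = b6 + b7 + b8) ∧
    (a0 + a3 + a6 = b2 + b5 + b8) ∧
    (a1 + a4 + a7 = b1 + b4 + b7) ∧
    (a2 + a5 + a8 = b0 + b3 + b6) ∧
    (a1 + a4 + a7 = 1/4) ∧ (a3 + a4 + a5 = 0) ∧
    (a6 + a7 + a8 = 0) ∧ (a0 + a1 + a2 = 1/4) := by
  have h2 : Real.sqrt 2 ^ 2 = 2 := Real.sq_sqrt (by norm_num)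
  have hdiv (x : ℝ) : x / (8 * Real.sqrt 2) = Real.sqrt 2 * x / 16 := by
    have h0 : Real.sqrt 2 ≠ 0 := by positivity
    field_simp
    linear_combination (-8 * x) * h2
  have hpq : (Real.sqrt 2 * Real.cos γ) ^ 2 + (Real.sqrt 2 * Real.sin γ) ^ 2 = 2 := by
    linear_combination Real.sqrt 2 ^ 2 * Real.sin_sq_add_cos_sq γ + h2
  rw [hdiv] at ha1 ha7 hb1 hb7
  rw [mul_add] at hS
  generalize Real.sqrt 2 * Real.cos γ = p at *
  generalize Real.sqrt 2 * Real.sin γ = q at *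
  have hT : (ε * S) ^ 2 = 2 + (p + q) := by
    have hε2 : ε ^ 2 = 1 := by rcases hε with rfl | rfl <;> norm_num
    have hnonneg : 0 ≤ 2 + (p + q) := by nlinarith [sq_nonneg (p + 1), sq_nonneg (q + 1)]
    rw [mul_pow, hε2, one_mul, hS, Real.sq_sqrt hnonneg]
  generalize ε * S = T at *
  subst ha0 ha1 ha2 ha3 ha4 ha5 ha6 ha7 ha8 hb0 hb1 hb2 hb3 hb4 hb5 hb6 hb7 hb8
  refine ⟨?_, ?_, ?_, ?_, ?_, ?_, ?_, ?_, ?_, ?_, ?_, ?_, ?_, ?_, ?_, ?_, ?_, ?_, ?_, ?_,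
    ?_, ?_, ?_, ?_⟩ <;> grind
end

section
/- Suppose the full system holds and additionally a₁+a₄+a₇ = 0 and a₃+a₄+a₅ = 0 (Case 4). Then b₁+b₄+b₇ = 0 and b₃+b₄+b₅ = 0, and moreover (a₆+a₇+a₈ = 0 or a₆+a₇+a₈ = 1/4) and (a₀+a₃+a₆ = 0 or a₀+a₃+a₆ = 1/4). -/
theorem stmt16 (a0 a1 a2 a3 a4 a5 a6 a7 a8 b0 b1 b2 b3 b4 b5 b6 b7 b8 : ℝ)
    (hN : 2*(a0 + a1 + a2 + a3 + a4 + a5 + a6 + a7 + a8 + b0 + b1 + b2 + b3 + b4 + b5 + b6 + b7 + b8) = 1)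
    (hO1 : (a0*a8) + (b0*b8) = 0)
    (hO2 : (a2*a6) + (b2*b6) = 0)
    (hO3 : (a1*a6 + a2*a7) + (b1*b6 + b2*b7) = 0)
    (hO4 : (a0*a7 + a1*a8) + (b0*b7 + b1*b8) = 0)
    (hO5 : (a2*a3 + a5*a6) + (b2*b3 + b5*b6) = 0)
    (hO6 : (a0*a5 + a3*a8) + (b0*b5 + b3*b8) = 0)
    (hO7 : (a0*a6 + a1*a7 + a2*a8) + (b0*b6 + b1*b7 + b2*b8) = 0)
    (hO8 : (a0*a2 + a3*a5 + a6*a8) + (b0*b2 + b3*b5 + b6*b8) = 0)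
    (hO9 : (a1*a3 + a2*a4 + a4*a6 + a5*a7) + (b1*b3 + b2*b4 + b4*b6 + b5*b7) = 0)
    (hO10 : (a0*a4 + a1*a5 + a3*a7 + a4*a8) + (b0*b4 + b1*b5 + b3*b7 + b4*b8) = 0)
    (hO11 : (a0*a3 + a1*a4 + a2*a5 + a3*a6 + a4*a7 + a5*a8) + (b0*b3 + b1*b4 + b2*b5 + b3*b6 + b4*b7 + b5*b8) = 0)
    (hO12 : (a0*a1 + a1*a2 + a3*a4 + a4*a5 + a6*a7 + a7*a8) + (b0*b1 + b1*b2 + b3*b4 + b4*b5 + b6*b7 + b7*b8) = 0)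
    (hO13 : a0^2 + a1^2 + a2^2 + a3^2 + a4^2 + a5^2 + a6^2 + a7^2 + a8^2 + b0^2 + b1^2 + b2^2 + b3^2 + b4^2 + b5^2 + b6^2 + b7^2 + b8^2 = 1/8)
    (hV1 : a0 + a1 + a2 = b0 + b1 + b2)
    (hV2 : a3 + a4 + a5 = b3 + b4 + b5)
    (hV3 : a6 + a7 + a8 = b6 + b7 + b8)
    (hV4 : a0 + a3 + a6 = b2 + b5 + b8)
    (hV5 : a1 + a4 + a7 = b1 + b4 + b7)
    (hV6 : a2 + a5 + a8 = b0 + b3 + b6)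
    (hC1 : a1 + a4 + a7 = 0)
    (hC2 : a3 + a4 + a5 = 0) :
    b1 + b4 + b7 = 0 ∧ b3 + b4 + b5 = 0 ∧
    (a6 + a7 + a8 = 0 ∨ a6 + a7 + a8 = 1/4) ∧
    (a0 + a3 + a6 = 0 ∨ a0 + a3 + a6 = 1/4) := by
  have hr : (a6 + a7 + a8) * (a6 + a7 + a8 - 1/4) = 0 := by
    have hab : (a0 + a1 + a2) * (a6 + a7 + a8) + (b0 + b1 + b2) * (b6 + b7 + b8) = 0 := by
      linear_combination hO1 + hO2 + hO3 + hO4 + hO7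
    have ha : a0 + a1 + a2 = 1/4 - (a6 + a7 + a8) := by linarith
    rw [← hV1, ← hV3, ha] at hab
    linear_combination -hab / 2
  have hc : (a0 + a3 + a6) * (a0 + a3 + a6 - 1/4) = 0 := by
    have hab : (a0 + a3 + a6) * (a2 + a5 + a8) + (b0 + b3 + b6) * (b2 + b5 + b8) = 0 := by
      linear_combination hO1 + hO2 + hO5 + hO6 + hO8
    have ha : a2 + a5 + a8 = 1/4 - (a0 + a3 + a6) := by linarith
    rw [← hV6, ← hV4, ha] at hab
    linear_combination -hab / 2
  exact ⟨hV5 ▸ hC1, hV2 ▸ hC2, (mul_eq_zero.mp hr).imp_right sub_eq_zero.mp,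
    (mul_eq_zero.mp hc).imp_right sub_eq_zero.mp⟩
end
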